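/- arXiv:2605.21274 — 6 statements merged into one kernel-verified Lean document; each statement's English description precedes it below -/
import Mathlib

section
/- Let ψ_0 = |0⟩ and ψ_k = √(1/3)|0⟩ + √(2/3)e^{2πi(k−1)/3}|1⟩ for k = 1,2,3 be the four SIC states in ℂ². Then (1/4) Σ_{k=0}^3 |ψ_k⟩⟨ψ_k| ⊗ |ψ_k⟩⟨ψ_k| = (1/6)(1_4 + S), where S is the 4×4 swap matrix on ℂ²⊗ℂ² (S(u⊗v) = v⊗u); i.e., the SIC states form a complex projective 2-design. -/
open Matrix
open scoped Kronecker

noncomputable section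

/-- The rank-one projector `|φ⟩⟨φ|`. -/
def outer {d : ℕ} (φ : Fin d → ℂ) : Matrix (Fin d) (Fin d) ℂ :=
  Matrix.of fun i j => φ i * star (φ j)

/-- The four SIC states in `ℂ²`: `ψ_0 = |0⟩` and
`ψ_k = √(1/3)|0⟩ + √(2/3) e^{2πi(k−1)/3} |1⟩` for `k = 1,2,3`. -/
def sic (k : Fin 4) : Fin 2 → ℂ :=
  if k = 0 then ![1, 0]
  else ![((Real.sqrt (1/3) : ℝ) : ℂ),
    ((Real.sqrt (2/3) : ℝ) : ℂ) *
      Complex.exp (2 * (Real.pi : ℂ) * Complex.I * (((k : ℕ) - 1 : ℕ) : ℂ) / 3)]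

/-- The swap operator `S` on `ℂ² ⊗ ℂ²`, `S(u ⊗ v) = v ⊗ u`. -/
def swapOp : Matrix (Fin 2 × Fin 2) (Fin 2 × Fin 2) ℂ :=
  Matrix.of fun p q => if p.1 = q.2 ∧ p.2 = q.1 then 1 else 0

/-- The primitive cube root of unity `e^{2πi/3}`. -/
def cubeRoot : ℂ := Complex.exp (2 * (Real.pi : ℂ) * Complex.I / 3)

theorem cubeRoot_isPrimitiveRoot : IsPrimitiveRoot cubeRoot 3 := by
  simpa [cubeRoot] using Complex.isPrimitiveRoot_exp 3 (by norm_num)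

theorem one_add_cubeRoot_add_sq : 1 + cubeRoot + cubeRoot ^ 2 = 0 := by
  simpa [Finset.sum_range_succ] using
    cubeRoot_isPrimitiveRoot.geom_sum_eq_zero (by norm_num)

theorem conj_cubeRoot : (starRingEnd ℂ) cubeRoot = cubeRoot ^ 2 := by
  rw [← Complex.inv_eq_conj (cubeRoot_isPrimitiveRoot.norm'_eq_one (by norm_num))]
  refine inv_eq_of_mul_eq_one_right ?_
  rw [← pow_succ', cubeRoot_isPrimitiveRoot.pow_eq_one]

theorem ofReal_sqrt_sq {x : ℝ} (hx : 0 ≤ x) : ((Real.sqrt x : ℝ) : ℂ) ^ 2 = x := by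
  rw [← Complex.ofReal_pow, Real.sq_sqrt hx]

theorem sic_zero : sic 0 = ![1, 0] := by simp [sic]

theorem sic_succ (j : Fin 3) :
    sic j.succ = ![((Real.sqrt (1/3) : ℝ) : ℂ),
      ((Real.sqrt (2/3) : ℝ) : ℂ) * cubeRoot ^ (j : ℕ)] := by
  rw [sic, if_neg (Fin.succ_ne_zero j), cubeRoot, ← Complex.exp_nat_mul, Fin.val_succ,
    Nat.add_sub_cancel]
  congr 4
  ring

/-- The four SIC states form a complex projective 2-design:
`(1/4) ∑ k, |ψ_k⟩⟨ψ_k| ⊗ |ψ_k⟩⟨ψ_k| = (1/6)(1 + S)`. -/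
theorem sic_states_two_design :
    ((1 / 4 : ℂ)) • ∑ k : Fin 4, (outer (sic k)) ⊗ₖ (outer (sic k))
      = ((1 / 6 : ℂ)) • ((1 : Matrix (Fin 2 × Fin 2) (Fin 2 × Fin 2) ℂ) + swapOp) := by
  have ha := ofReal_sqrt_sq (x := 1 / 3) (by norm_num)
  have hb := ofReal_sqrt_sq (x := 2 / 3) (by norm_num)
  have hw := one_add_cubeRoot_add_sq
  rw [Fin.sum_univ_succ, Fin.sum_univ_three, sic_zero]
  simp only [sic_succ]
  generalize Real.sqrt (1 / 3) = a at *
  generalize Real.sqrt (2 / 3) = b at *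
  push_cast at ha hb
  ext ⟨i, j⟩ ⟨k, l⟩
  fin_cases i <;> fin_cases j <;> fin_cases k <;> fin_cases l <;>
    simp [outer, swapOp, conj_cubeRoot] <;> grind
end
end

section
/- Let K_1 = (1/√6)·[[2,0],[0,1],[0,1],[0,0]] and K_2 = (1/√6)·[[0,0],[1,0],[1,0],[0,2]] be 4×2 complex matrices. Then (i) K_1†K_1 + K_2†K_2 = 1_2, and (ii) for every unit vector ψ ∈ ℂ², writing E(ρ) = K_1 ρ K_1† + K_2 ρ K_2†, both two-dimensional reduced output states satisfy tr_B[E(|ψ⟩⟨ψ|)] = tr_A[E(|ψ⟩⟨ψ|)] = (2/3)|ψ⟩⟨ψ| + (1/6)·1_2; in particular each clone has fidelity ⟨ψ| tr_B[E(|ψ⟩⟨ψ|)] |ψ⟩ = 5/6. -/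
open Matrix

noncomputable section

/-- Encode a pair `(a,b) ∈ {0,1}²` as the row index `2a+b ∈ Fin 4`. -/
def pr (p : Fin 2 × Fin 2) : Fin 4 := ⟨2 * p.1.val + p.2.val, by omega⟩

/-- Partial trace over the second (B) output qubit. -/
def trB (M : Matrix (Fin 2 × Fin 2) (Fin 2 × Fin 2) ℂ) : Matrix (Fin 2) (Fin 2) ℂ :=
  Matrix.of fun a a' => ∑ b : Fin 2, M (a, b) (a', b)

/-- Partial trace over the first (A) output qubit. -/
def trA (M : Matrix (Fin 2 × Fin 2) (Fin 2 × Fin 2) ℂ) : Matrix (Fin 2) (Fin 2) ℂ :=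
  Matrix.of fun b b' => ∑ a : Fin 2, M (a, b) (a, b')

/-- `⟨ψ| M |ψ⟩`. -/
def fid {d : ℕ} (ψ : Fin d → ℂ) (M : Matrix (Fin d) (Fin d) ℂ) : ℂ :=
  ∑ i, ∑ j, star (ψ i) * M i j * ψ j

/-- The first Kraus operator of the universal symmetric 1→2 cloner. -/
def K₁ : Matrix (Fin 2 × Fin 2) (Fin 2) ℂ :=
  Matrix.of fun p j =>
    ((1 / Real.sqrt 6 : ℝ) : ℂ) * !![(2 : ℂ), 0; 0, 1; 0, 1; 0, 0] (pr p) j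

/-- The second Kraus operator of the universal symmetric 1→2 cloner. -/
def K₂ : Matrix (Fin 2 × Fin 2) (Fin 2) ℂ :=
  Matrix.of fun p j =>
    ((1 / Real.sqrt 6 : ℝ) : ℂ) * !![(0 : ℂ), 0; 1, 0; 1, 0; 0, 2] (pr p) j

/-- The channel `E(ρ) = K₁ ρ K₁† + K₂ ρ K₂†` applied to `|ψ⟩⟨ψ|`. -/
def Eout (ψ : Fin 2 → ℂ) : Matrix (Fin 2 × Fin 2) (Fin 2 × Fin 2) ℂ :=
  K₁ * outer ψ * K₁ᴴ + K₂ * outer ψ * K₂ᴴ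

/-- The normalization constant `1/√6` of the Kraus operators squares to `1/6`. -/
theorem one_div_sqrt_six_sq : ((1 / Real.sqrt 6 : ℝ) : ℂ) ^ 2 = 1 / 6 := by
  rw [← Complex.ofReal_pow, div_pow, Real.sq_sqrt (by norm_num)]
  norm_num

theorem kraus_completeness : K₁ᴴ * K₁ + K₂ᴴ * K₂ = 1 := by
  have hs := one_div_sqrt_six_sq
  ext i j
  simp only [Matrix.add_apply, mul_apply, conjTranspose_apply, Fintype.sum_prod_type,
    Fin.sum_univ_two, K₁, K₂, of_apply, star_mul', Complex.star_def, Complex.conj_ofReal]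
  generalize ((1 / Real.sqrt 6 : ℝ) : ℂ) = s at hs ⊢
  fin_cases i <;> fin_cases j <;> simp [pr, Complex.conj_ofNat] <;> linear_combination 6 * hs

theorem sum_mul_star_eq_one {ψ : Fin 2 → ℂ} (hψ : ∑ i, ‖ψ i‖ ^ 2 = 1) :
    ψ 0 * star (ψ 0) + ψ 1 * star (ψ 1) = 1 := by
  rw [Fin.sum_univ_two] at hψ
  simp only [Complex.star_def, Complex.mul_conj']
  exact_mod_cast hψ

theorem trB_Eout {ψ : Fin 2 → ℂ} (hψ : ψ 0 * star (ψ 0) + ψ 1 * star (ψ 1) = 1) :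
    trB (Eout ψ) = ((2 / 3 : ℝ) : ℂ) • outer ψ + ((1 / 6 : ℝ) : ℂ) • 1 := by
  have hs := one_div_sqrt_six_sq
  ext i j
  simp only [trB, Eout, outer, Matrix.add_apply, Matrix.smul_apply, smul_eq_mul, mul_apply,
    conjTranspose_apply, Fin.sum_univ_two, K₁, K₂, of_apply, star_mul', Complex.star_def,
    Complex.conj_ofReal] at hψ ⊢
  generalize ((1 / Real.sqrt 6 : ℝ) : ℂ) = s at hs ⊢
  fin_cases i <;> fin_cases j <;> simp [pr, Complex.conj_ofNat]
  · linear_combination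
      (5 * (ψ 0 * starRingEnd ℂ (ψ 0)) + ψ 1 * starRingEnd ℂ (ψ 1)) * hs + (1 / 6) * hψ
  · linear_combination (4 * (ψ 0 * starRingEnd ℂ (ψ 1))) * hs
  · linear_combination (4 * (ψ 1 * starRingEnd ℂ (ψ 0))) * hs
  · linear_combination
      (ψ 0 * starRingEnd ℂ (ψ 0) + 5 * (ψ 1 * starRingEnd ℂ (ψ 1))) * hs + (1 / 6) * hψ

theorem trA_Eout (ψ : Fin 2 → ℂ) : trA (Eout ψ) = trB (Eout ψ) := by
  ext i j
  simp only [trA, trB, Eout, Matrix.add_apply, mul_apply,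
    conjTranspose_apply, Fin.sum_univ_two, K₁, K₂, of_apply]
  fin_cases i <;> fin_cases j <;> simp [pr]

/-- The fidelity of a unit vector with a shrunk copy of its own projector. -/
theorem fid_smul_outer_add_smul_one {ψ : Fin 2 → ℂ}
    (hψ : ψ 0 * star (ψ 0) + ψ 1 * star (ψ 1) = 1) (a b : ℂ) :
    fid ψ (a • outer ψ + b • 1) = a + b := by
  simp only [fid, outer, Fin.sum_univ_two, Matrix.add_apply, Matrix.smul_apply, smul_eq_mul, of_apply,
    one_apply_eq, one_apply_ne (zero_ne_one : (0 : Fin 2) ≠ 1),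
    one_apply_ne (one_ne_zero : (1 : Fin 2) ≠ 0)]
  linear_combination (a * (ψ 0 * star (ψ 0) + ψ 1 * star (ψ 1) + 1) + b) * hψ

/-- The universal symmetric 1→2 cloner: the Kraus operators satisfy the
completeness relation, and for every unit vector `ψ` both reduced output states
equal `(2/3)|ψ⟩⟨ψ| + (1/6)·1`, so each clone has fidelity `5/6`. -/
theorem universal_one_to_two_cloner :
    K₁ᴴ * K₁ + K₂ᴴ * K₂ = 1 ∧
    ∀ ψ : Fin 2 → ℂ, (∑ i, ‖ψ i‖ ^ 2 = 1) →
      trB (Eout ψ) = ((2 / 3 : ℝ) : ℂ) • outer ψ + ((1 / 6 : ℝ) : ℂ) • 1 ∧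
      trA (Eout ψ) = ((2 / 3 : ℝ) : ℂ) • outer ψ + ((1 / 6 : ℝ) : ℂ) • 1 ∧
      fid ψ (trB (Eout ψ)) = 5 / 6 ∧
      fid ψ (trA (Eout ψ)) = 5 / 6 := by
  refine ⟨kraus_completeness, fun ψ hψ => ?_⟩
  have h := sum_mul_star_eq_one hψ
  rw [trA_Eout, trB_Eout h, fid_smul_outer_add_smul_one h]
  norm_num
end
end

section
/- For every finite family {K_k} of 4×2 complex Kraus matrices satisfying Σ_k K_k† K_k = 1_2, defining E(ρ) = Σ_k K_k ρ K_k† and, for each unit vector ψ ∈ ℂ², the single-clone fidelities F_A(ψ) = ⟨ψ| tr_B[E(|ψ⟩⟨ψ|)] |ψ⟩ and F_B(ψ) = ⟨ψ| tr_A[E(|ψ⟩⟨ψ|)] |ψ⟩, the average over the four SIC states ψ_0,…,ψ_3 satisfies (1/4) Σ_{k=0}^3 (F_A(ψ_k) + F_B(ψ_k))/2 ≤ 5/6. -/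
open Matrix

noncomputable section

open scoped ComplexConjugate

/-- The map `M ↦ ⟨ψ| M |ψ⟩` is additive over finite sums. -/
lemma fid_sum {d : ℕ} {ι : Type*} (s : Finset ι) (ψ : Fin d → ℂ)
    (M : ι → Matrix (Fin d) (Fin d) ℂ) :
    fid ψ (∑ l ∈ s, M l) = ∑ l ∈ s, fid ψ (M l) := by
  classical
  induction s using Finset.induction_on with
  | empty => simp [fid]
  | insert a s ha ih =>
    rw [Finset.sum_insert ha, Finset.sum_insert ha, ← ih]
    simp only [fid, Matrix.add_apply, mul_add, add_mul, Finset.sum_add_distrib]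

lemma trB_sum {ι : Type*} (s : Finset ι) (M : ι → Matrix (Fin 2 × Fin 2) (Fin 2 × Fin 2) ℂ) :
    trB (∑ l ∈ s, M l) = ∑ l ∈ s, trB (M l) := by
  ext i j
  simp only [trB, Matrix.of_apply, Matrix.sum_apply]
  exact Finset.sum_comm

lemma trA_sum {ι : Type*} (s : Finset ι) (M : ι → Matrix (Fin 2 × Fin 2) (Fin 2 × Fin 2) ℂ) :
    trA (∑ l ∈ s, M l) = ∑ l ∈ s, trA (M l) := by
  ext i j
  simp only [trA, Matrix.of_apply, Matrix.sum_apply]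
  exact Finset.sum_comm

/-- The fidelity of the first clone, written through the blocks of the Kraus operator. -/
lemma fid_trB_conj (ψ : Fin 2 → ℂ) (K : Matrix (Fin 2 × Fin 2) (Fin 2) ℂ) :
    fid ψ (trB (K * outer ψ * Kᴴ))
      = ∑ b, (Complex.normSq (fid ψ (K.submatrix (fun a => (a, b)) id)) : ℂ) := by
  simp only [← Complex.mul_conj, fid, trB, outer, Matrix.of_apply, Matrix.mul_apply,
    Fin.sum_univ_two, Matrix.conjTranspose_apply, Matrix.submatrix_apply, id, map_add, map_mul,
    Complex.star_def, Complex.conj_conj]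
  ring

/-- The fidelity of the second clone, written through the blocks of the Kraus operator. -/
lemma fid_trA_conj (ψ : Fin 2 → ℂ) (K : Matrix (Fin 2 × Fin 2) (Fin 2) ℂ) :
    fid ψ (trA (K * outer ψ * Kᴴ))
      = ∑ a, (Complex.normSq (fid ψ (K.submatrix (fun b => (a, b)) id)) : ℂ) := by
  simp only [← Complex.mul_conj, fid, trA, outer, Matrix.of_apply, Matrix.mul_apply,
    Fin.sum_univ_two, Matrix.conjTranspose_apply, Matrix.submatrix_apply, id, map_add, map_mul,
    Complex.star_def, Complex.conj_conj]
  ring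

/-- The three SIC states other than `|0⟩` carry the powers of a primitive cube root of unity. -/
lemma exists_sic_eq : ∃ ω p q : ℂ, 1 + ω + ω ^ 2 = 0 ∧ conj ω = ω ^ 2 ∧
    conj p = p ∧ conj q = q ∧ p ^ 2 = 1 / 3 ∧ q ^ 2 = 2 / 3 ∧ sic 0 = ![1, 0] ∧
    sic 1 = ![p, q] ∧ sic 2 = ![p, q * ω] ∧ sic 3 = ![p, q * ω ^ 2] := by
  have hprim : IsPrimitiveRoot (Complex.exp (2 * Real.pi * Complex.I / 3)) 3 := by
    exact_mod_cast Complex.isPrimitiveRoot_exp 3 (by norm_num)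
  refine ⟨Complex.exp (2 * Real.pi * Complex.I / 3), (Real.sqrt (1 / 3) : ℝ),
    (Real.sqrt (2 / 3) : ℝ), ?_, ?_, Complex.conj_ofReal _, Complex.conj_ofReal _, ?_, ?_,
    ?_, ?_, ?_, ?_⟩
  · simpa [Finset.sum_range_succ] using hprim.geom_sum_eq_zero (by norm_num)
  · have hconj : conj (Complex.exp (2 * Real.pi * Complex.I / 3))
        = Complex.exp (-(2 * Real.pi * Complex.I / 3)) := by
      rw [← Complex.exp_conj]
      simp [neg_div, map_ofNat]
    rw [hconj, Complex.exp_neg]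
    exact inv_eq_of_mul_eq_one_right (by rw [← pow_succ']; exact hprim.pow_eq_one)
  · rw [← Complex.ofReal_pow, Real.sq_sqrt (by norm_num)]
    norm_num
  · rw [← Complex.ofReal_pow, Real.sq_sqrt (by norm_num)]
    norm_num
  · simp [sic]
  · simp [sic]
  · simp [sic]
  · simp [sic, ← Complex.exp_nat_mul]
    ring_nf

/-- The SIC states form a complex projective 2-design. -/
lemma sum_normSq_fid_sic (M : Matrix (Fin 2) (Fin 2) ℂ) :
    ∑ k, Complex.normSq (fid (sic k) M)
      = 2 / 3 * (Complex.normSq M.trace + ∑ i, ∑ j, Complex.normSq (M i j)) := by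
  obtain ⟨ω, p, q, hω, hcω, hcp, hcq, hp, hq, h0, h1, h2, h3⟩ := exists_sic_eq
  have hω3 : ω ^ 3 = 1 := by linear_combination (ω - 1) * hω
  have hω4 : ω ^ 4 = ω := by linear_combination ω * hω3
  have hsic1 : fid (sic 1) M = M 0 0 / 3 + p * q * (M 0 1 + M 1 0) + 2 / 3 * M 1 1 := by
    simp [fid, h1, Fin.sum_univ_two, hcp, hcq]
    linear_combination M 0 0 * hp + M 1 1 * hq
  have hsic2 : fid (sic 2) M
      = M 0 0 / 3 + p * q * (ω * M 0 1 + ω ^ 2 * M 1 0) + 2 / 3 * M 1 1 := by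
    simp [fid, h2, Fin.sum_univ_two, hcp, hcq, hcω]
    linear_combination M 0 0 * hp + M 1 1 * (ω ^ 3 * hq + 2 / 3 * hω3)
  have hsic3 : fid (sic 3) M
      = M 0 0 / 3 + p * q * (ω ^ 2 * M 0 1 + ω * M 1 0) + 2 / 3 * M 1 1 := by
    simp [fid, h3, Fin.sum_univ_two, hcp, hcq, hcω]
    linear_combination M 0 0 * hp + M 1 1 * (ω ^ 6 * hq + 2 / 3 * (ω ^ 3 + 1) * hω3)
      + p * q * M 1 0 * hω4
  have hsic0 : fid (sic 0) M = M 0 0 := by simp [fid, h0, Fin.sum_univ_two]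
  have hpq : (p * q) ^ 2 = 2 / 9 := by rw [mul_pow, hp, hq]; norm_num
  rw [← Complex.ofReal_inj]
  simp only [Fin.sum_univ_four, hsic0, hsic1, hsic2, hsic3, Matrix.trace_fin_two,
    Fin.sum_univ_two]
  push_cast
  simp only [← Complex.mul_conj, map_add, map_mul, map_div₀, map_pow, map_ofNat]
  simp only [hcp, hcq, hcω]
  generalize conj (M 0 0) = a
  generalize conj (M 0 1) = b
  generalize conj (M 1 0) = c
  generalize conj (M 1 1) = d
  generalize p * q = t at *
  grind

/-- The optimality bound for a single Kraus operator. -/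
lemma normSq_trace_blocks_le (K : Matrix (Fin 2 × Fin 2) (Fin 2) ℂ) :
    (∑ b, Complex.normSq (K.submatrix (fun a => (a, b)) id).trace)
      + ∑ a, Complex.normSq (K.submatrix (fun b => (a, b)) id).trace
      ≤ 3 * ∑ x, ∑ j, Complex.normSq (K x j) := by
  have key (x y z : ℂ) : Complex.normSq (x + y) + Complex.normSq (x + z)
      ≤ 3 * (Complex.normSq x + Complex.normSq y + Complex.normSq z) := by
    have h1 := Complex.normSq_nonneg (x - y - z)
    have h2 := Complex.normSq_nonneg (y - z)
    simp only [Complex.normSq_apply, Complex.add_re, Complex.add_im, Complex.sub_re,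
      Complex.sub_im] at *
    linarith
  have h1 := key (K (0, 0) 0) (K (1, 0) 1) (K (0, 1) 1)
  have h2 := key (K (1, 1) 1) (K (0, 1) 0) (K (1, 0) 0)
  have h3 := Complex.normSq_nonneg (K (0, 0) 1)
  have h4 := Complex.normSq_nonneg (K (1, 1) 0)
  simp only [Fin.sum_univ_two, Fintype.sum_prod_type, Matrix.trace_fin_two,
    Matrix.submatrix_apply, id]
  rw [add_comm (K (0, 1) 0), add_comm (K (1, 0) 0)]
  linarith

/-- The contribution of a single Kraus operator to the sum of the clone fidelities. -/
lemma sum_fid_sic_le (K : Matrix (Fin 2 × Fin 2) (Fin 2) ℂ) :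
    ∑ k, ((fid (sic k) (trB (K * outer (sic k) * Kᴴ))).re
        + (fid (sic k) (trA (K * outer (sic k) * Kᴴ))).re)
      ≤ 10 / 3 * ∑ x, ∑ j, Complex.normSq (K x j) := by
  have h := normSq_trace_blocks_le K
  simp only [fid_trB_conj, fid_trA_conj, ← Complex.ofReal_sum, Complex.ofReal_re]
  simp only [Fin.sum_univ_two, Finset.sum_add_distrib, sum_normSq_fid_sic, Fintype.sum_prod_type,
    Matrix.submatrix_apply, id] at h ⊢
  linarith

lemma sum_normSq_eq_trace {m n : Type*} [Fintype m] [Fintype n] (K : Matrix m n ℂ) :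
    ∑ x, ∑ j, Complex.normSq (K x j) = (Kᴴ * K).trace.re := by
  simp only [Matrix.trace, Matrix.diag, Matrix.mul_apply, Matrix.conjTranspose_apply,
    Complex.re_sum, Complex.star_def, ← Complex.normSq_eq_conj_mul_self, Complex.ofReal_re]
  exact Finset.sum_comm

/-- Optimality of the universal symmetric 1→2 cloner: for every 1→2 qubit channel
given by Kraus operators, the single-clone fidelities averaged over the four SIC
states (and over both clones) are at most `5/6`. -/
theorem universal_cloning_bound_sic {r : ℕ}
    (K : Fin r → Matrix (Fin 2 × Fin 2) (Fin 2) ℂ)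
    (hK : ∑ k, (K k)ᴴ * K k = 1) :
    (1 / 4 : ℝ) * ∑ k : Fin 4,
        ((fid (sic k) (trB (∑ l, K l * outer (sic k) * (K l)ᴴ))).re
          + (fid (sic k) (trA (∑ l, K l * outer (sic k) * (K l)ᴴ))).re) / 2
      ≤ 5 / 6 := by
  have htr : ∑ l, ∑ x, ∑ j, Complex.normSq (K l x j) = 2 := by
    simp only [sum_normSq_eq_trace]
    rw [← Complex.re_sum, ← Matrix.trace_sum, hK]
    simp
  have hsum := Finset.sum_le_sum fun l (_ : l ∈ Finset.univ) => sum_fid_sic_le (K l)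
  rw [← Finset.mul_sum, htr, Finset.sum_comm] at hsum
  simp only [trB_sum, trA_sum, fid_sum, Complex.re_sum, ← Finset.sum_add_distrib,
    ← Finset.sum_div]
  linarith
end
end

section
/- For every finite family {K_k} of 4×2 complex Kraus matrices satisfying Σ_k K_k† K_k = 1_2, defining E(ρ) = Σ_k K_k ρ K_k† and the single-clone fidelities F_A(ψ) = ⟨ψ| tr_B[E(|ψ⟩⟨ψ|)] |ψ⟩ and F_B(ψ) = ⟨ψ| tr_A[E(|ψ⟩⟨ψ|)] |ψ⟩, the average over the three equatorial states ψ_k = (|0⟩ + e^{2πi(k−1)/3}|1⟩)/√2, k = 1,2,3, satisfies (1/3) Σ_{k=1}^3 (F_A(ψ_k) + F_B(ψ_k))/2 ≤ 1/2 + √2/4. -/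
open Matrix

noncomputable section

/-- The three equatorial states `ψ_k = (|0⟩ + e^{2πi(k−1)/3}|1⟩)/√2`, `k = 1,2,3`,
indexed by `k ∈ Fin 3` (so the phase is `2πk/3` for `k = 0,1,2`). -/
def eqTriple (k : Fin 3) : Fin 2 → ℂ :=
  ![((1 / Real.sqrt 2 : ℝ) : ℂ),
    Complex.exp (2 * (Real.pi : ℂ) * Complex.I * ((k : ℕ) : ℂ) / 3) *
      ((1 / Real.sqrt 2 : ℝ) : ℂ)]

open Complex in
/-- The three equatorial phases are `1` and the two primitive cube roots of unity. -/
lemma eqTriple_values :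
    eqTriple 0 = ![((1 / Real.sqrt 2 : ℝ) : ℂ), 1 * ((1 / Real.sqrt 2 : ℝ) : ℂ)] ∧
    eqTriple 1 = ![((1 / Real.sqrt 2 : ℝ) : ℂ),
      (⟨-1 / 2, Real.sqrt 3 / 2⟩ : ℂ) * ((1 / Real.sqrt 2 : ℝ) : ℂ)] ∧
    eqTriple 2 = ![((1 / Real.sqrt 2 : ℝ) : ℂ),
      (⟨-1 / 2, -(Real.sqrt 3 / 2)⟩ : ℂ) * ((1 / Real.sqrt 2 : ℝ) : ℂ)] := by
  have hc : Real.cos (2 * Real.pi / 3) = -1 / 2 := by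
    rw [show 2 * Real.pi / 3 = Real.pi - Real.pi / 3 by ring, Real.cos_pi_sub,
      Real.cos_pi_div_three]
    norm_num
  have hs : Real.sin (2 * Real.pi / 3) = Real.sqrt 3 / 2 := by
    rw [show 2 * Real.pi / 3 = Real.pi - Real.pi / 3 by ring, Real.sin_pi_sub,
      Real.sin_pi_div_three]
  have h1 : exp (2 * (Real.pi : ℂ) * I / 3) = ⟨-1 / 2, Real.sqrt 3 / 2⟩ := by
    rw [show 2 * (Real.pi : ℂ) * I / 3 = ((2 * Real.pi / 3 : ℝ) : ℂ) * I by push_cast; ring]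
    apply Complex.ext
    · rw [exp_ofReal_mul_I_re, hc]
    · rw [exp_ofReal_mul_I_im, hs]
  have h2 : exp (2 * (Real.pi : ℂ) * I * 2 / 3) = ⟨-1 / 2, -(Real.sqrt 3 / 2)⟩ := by
    rw [show 2 * (Real.pi : ℂ) * I * 2 / 3 = ((2 : ℕ) : ℂ) * (2 * (Real.pi : ℂ) * I / 3) by
      push_cast; ring, exp_nat_mul, h1, sq]
    have h3 : Real.sqrt 3 * Real.sqrt 3 = 3 := Real.mul_self_sqrt (by norm_num)
    apply Complex.ext
    · simp only [mul_re]; linarith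
    · simp only [mul_im]; ring
  refine ⟨by simp [eqTriple], ?_, ?_⟩
  · simp [eqTriple, h1]
  · simp [eqTriple, h2]

/-- Additivity of the first-clone fidelity in the Kraus family. -/
lemma fid_trB_sum {r : ℕ} (ψ : Fin 2 → ℂ)
    (M : Fin r → Matrix (Fin 2 × Fin 2) (Fin 2 × Fin 2) ℂ) :
    fid ψ (trB (∑ l, M l)) = ∑ l, fid ψ (trB (M l)) := by
  simp only [fid, trB, Fin.sum_univ_two, Matrix.of_apply, Matrix.sum_apply, mul_add, add_mul,
    Finset.mul_sum, Finset.sum_mul, Finset.sum_add_distrib]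

/-- Additivity of the second-clone fidelity in the Kraus family. -/
lemma fid_trA_sum {r : ℕ} (ψ : Fin 2 → ℂ)
    (M : Fin r → Matrix (Fin 2 × Fin 2) (Fin 2 × Fin 2) ℂ) :
    fid ψ (trA (∑ l, M l)) = ∑ l, fid ψ (trA (M l)) := by
  simp only [fid, trA, Fin.sum_univ_two, Matrix.of_apply, Matrix.sum_apply, mul_add, add_mul,
    Finset.mul_sum, Finset.sum_mul, Finset.sum_add_distrib]

/-- The transition amplitude of a `2 × 2` matrix at the state `(1, w)`. -/
def amplitude (w : ℂ) (L : Matrix (Fin 2) (Fin 2) ℂ) : ℂ :=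
  L 0 0 + L 1 1 + w * L 0 1 + star w * L 1 0

lemma inv_sqrt_two_sq : (((1 / Real.sqrt 2 : ℝ) : ℂ)) * ((1 / Real.sqrt 2 : ℝ) : ℂ) = 1 / 2 := by
  rw [← Complex.ofReal_mul, div_mul_div_comm, Real.mul_self_sqrt (by norm_num)]
  norm_num

/-- Transition probability of a `2 × 2` matrix at an equatorial state. -/
lemma fid_mul_outer (w : ℂ) (hw : w * star w = 1) (L : Matrix (Fin 2) (Fin 2) ℂ) :
    fid ![((1 / Real.sqrt 2 : ℝ) : ℂ), w * ((1 / Real.sqrt 2 : ℝ) : ℂ)]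
      (L * outer ![((1 / Real.sqrt 2 : ℝ) : ℂ), w * ((1 / Real.sqrt 2 : ℝ) : ℂ)] * Lᴴ)
      = ((Complex.normSq (amplitude w L) / 4 : ℝ) : ℂ) := by
  have hs := inv_sqrt_two_sq
  have hss : star ((1 / Real.sqrt 2 : ℝ) : ℂ) = ((1 / Real.sqrt 2 : ℝ) : ℂ) :=
    Complex.conj_ofReal _
  generalize ((1 / Real.sqrt 2 : ℝ) : ℂ) = s at hs hss ⊢
  have hfactor : fid ![s, w * s] (L * outer ![s, w * s] * Lᴴ)
      = (s * s) * (s * s) * ((L 0 0 + w * L 0 1 + star w * (L 1 0 + w * L 1 1))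
        * star (L 0 0 + w * L 0 1 + star w * (L 1 0 + w * L 1 1))) := by
    simp only [fid, outer, Matrix.mul_apply, Fin.sum_univ_two, Matrix.of_apply,
      Matrix.conjTranspose_apply, Matrix.cons_val_zero, Matrix.cons_val_one, star_mul', star_add,
      star_star, hss]
    ring
  have hamp : L 0 0 + w * L 0 1 + star w * (L 1 0 + w * L 1 1) = amplitude w L := by
    simp only [amplitude]
    linear_combination L 1 1 * hw
  rw [hfactor, hamp, hs, Complex.star_def, Complex.mul_conj]
  push_cast
  ring

/-- Orthogonality of the characters of the group of cube roots of unity. -/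
lemma sum_normSq_amplitude (L : Matrix (Fin 2) (Fin 2) ℂ) :
    Complex.normSq (amplitude 1 L)
      + Complex.normSq (amplitude ⟨-1 / 2, Real.sqrt 3 / 2⟩ L)
      + Complex.normSq (amplitude ⟨-1 / 2, -(Real.sqrt 3 / 2)⟩ L)
      = 3 * (Complex.normSq (L 0 0 + L 1 1) + Complex.normSq (L 0 1)
        + Complex.normSq (L 1 0)) := by
  have h3 : Real.sqrt 3 ^ 2 = 3 := Real.sq_sqrt (by norm_num)
  simp only [amplitude, Complex.normSq_apply, Complex.star_def, Complex.add_re, Complex.add_im,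
    Complex.mul_re, Complex.mul_im, Complex.conj_re, Complex.conj_im, Complex.one_re,
    Complex.one_im]
  ring_nf
  rw [h3]
  ring

/-- Transition probability of a `2 × 2` matrix averaged over the three equatorial states. -/
lemma sum_fid_eqTriple (L : Matrix (Fin 2) (Fin 2) ℂ) :
    ∑ k : Fin 3, (fid (eqTriple k) (L * outer (eqTriple k) * Lᴴ)).re
      = 3 / 4 * (Complex.normSq (L 0 0 + L 1 1) + Complex.normSq (L 0 1)
        + Complex.normSq (L 1 0)) := by
  obtain ⟨h0, h1, h2⟩ := eqTriple_values
  have h3 : Real.sqrt 3 * Real.sqrt 3 = 3 := Real.mul_self_sqrt (by norm_num)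
  have u1 : (⟨-1 / 2, Real.sqrt 3 / 2⟩ : ℂ) * star (⟨-1 / 2, Real.sqrt 3 / 2⟩ : ℂ) = 1 := by
    rw [Complex.star_def, Complex.mul_conj, Complex.normSq_mk, ← Complex.ofReal_one]
    congr 1
    linarith
  have u2 : (⟨-1 / 2, -(Real.sqrt 3 / 2)⟩ : ℂ) * star (⟨-1 / 2, -(Real.sqrt 3 / 2)⟩ : ℂ) = 1 := by
    rw [Complex.star_def, Complex.mul_conj, Complex.normSq_mk, ← Complex.ofReal_one]
    congr 1
    linarith
  rw [Fin.sum_univ_three, h0, h1, h2, fid_mul_outer 1 (by simp), fid_mul_outer _ u1,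
    fid_mul_outer _ u2]
  simp only [Complex.ofReal_re]
  linarith [sum_normSq_amplitude L]

/-- The fidelity of the first clone is a sum over the outcomes `b` of the second qubit. -/
lemma fid_trB_kraus (ψ : Fin 2 → ℂ) (K : Matrix (Fin 2 × Fin 2) (Fin 2) ℂ) :
    fid ψ (trB (K * outer ψ * Kᴴ))
      = ∑ b, fid ψ (K.submatrix (·, b) id * outer ψ * (K.submatrix (·, b) id)ᴴ) := by
  simp only [fid, trB, Fin.sum_univ_two, Matrix.of_apply, Matrix.mul_apply,
    Matrix.conjTranspose_apply, Matrix.submatrix_apply, id]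
  ring

/-- The fidelity of the second clone is a sum over the outcomes `a` of the first qubit. -/
lemma fid_trA_kraus (ψ : Fin 2 → ℂ) (K : Matrix (Fin 2 × Fin 2) (Fin 2) ℂ) :
    fid ψ (trA (K * outer ψ * Kᴴ))
      = ∑ a, fid ψ (K.submatrix (a, ·) id * outer ψ * (K.submatrix (a, ·) id)ᴴ) := by
  simp only [fid, trA, Fin.sum_univ_two, Matrix.of_apply, Matrix.mul_apply,
    Matrix.conjTranspose_apply, Matrix.submatrix_apply, id]
  ring

lemma cross_term_le (x y z : ℝ) :
    2 * (x * y + x * z) ≤ Real.sqrt 2 * (x ^ 2 + y ^ 2 + z ^ 2) := by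
  have h2 : Real.sqrt 2 ^ 2 = 2 := Real.sq_sqrt (by norm_num)
  have h : 0 ≤ Real.sqrt 2 * ((x - Real.sqrt 2 / 2 * (y + z)) ^ 2 + (y - z) ^ 2 / 2) := by
    positivity
  have e : Real.sqrt 2 * ((x - Real.sqrt 2 / 2 * (y + z)) ^ 2 + (y - z) ^ 2 / 2)
      = Real.sqrt 2 * (x ^ 2 + y ^ 2 + z ^ 2) - 2 * (x * y + x * z) := by
    linear_combination (-x * (y + z) + Real.sqrt 2 / 4 * (y + z) ^ 2) * h2
  linarith

/-- The cloning bound for a single Kraus operator. -/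
lemma kraus_cloning_bound (K : Matrix (Fin 2 × Fin 2) (Fin 2) ℂ) :
    ∑ k : Fin 3, ((fid (eqTriple k) (trB (K * outer (eqTriple k) * Kᴴ))).re
        + (fid (eqTriple k) (trA (K * outer (eqTriple k) * Kᴴ))).re)
      ≤ (3 / 2 + 3 * Real.sqrt 2 / 4) * (Kᴴ * K).trace.re := by
  simp only [fid_trB_kraus, fid_trA_kraus, Fin.sum_univ_two (M := ℂ), Complex.add_re,
    Finset.sum_add_distrib, sum_fid_eqTriple, Matrix.submatrix_apply, id]
  simp only [Matrix.trace, Matrix.diag_apply, Matrix.mul_apply, Matrix.conjTranspose_apply,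
    Fintype.sum_prod_type, Fin.sum_univ_two, Complex.add_re, Complex.add_im, Complex.mul_re,
    Complex.star_def, Complex.conj_re, Complex.conj_im, Complex.normSq_apply]
  have c1 := cross_term_le (K (0, 0) 0).re (K (0, 1) 1).re (K (1, 0) 1).re
  have c2 := cross_term_le (K (0, 0) 0).im (K (0, 1) 1).im (K (1, 0) 1).im
  have c3 := cross_term_le (K (1, 1) 1).re (K (0, 1) 0).re (K (1, 0) 0).re
  have c4 := cross_term_le (K (1, 1) 1).im (K (0, 1) 0).im (K (1, 0) 0).im
  have hn : 0 ≤ Real.sqrt 2 * ((K (0, 0) 1).re ^ 2 + (K (0, 0) 1).im ^ 2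
      + (K (1, 1) 0).re ^ 2 + (K (1, 1) 0).im ^ 2) := by positivity
  linarith

/-- Optimality of the phase-covariant 1→2 cloner: for every 1→2 qubit channel
given by Kraus operators, the single-clone fidelities averaged over the three
equatorial states (and over both clones) are at most `1/2 + √2/4`. -/
theorem phase_covariant_cloning_bound {r : ℕ}
    (K : Fin r → Matrix (Fin 2 × Fin 2) (Fin 2) ℂ)
    (hK : ∑ k, (K k)ᴴ * K k = 1) :
    (1 / 3 : ℝ) * ∑ k : Fin 3,
        ((fid (eqTriple k) (trB (∑ l, K l * outer (eqTriple k) * (K l)ᴴ))).re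
          + (fid (eqTriple k) (trA (∑ l, K l * outer (eqTriple k) * (K l)ᴴ))).re) / 2
      ≤ 1 / 2 + Real.sqrt 2 / 4 := by
  have htr : ∑ l, ((K l)ᴴ * K l).trace.re = 2 := by
    rw [← Complex.re_sum, ← Matrix.trace_sum, hK]
    simp
  have hsum := Finset.sum_le_sum fun l (_ : l ∈ Finset.univ) => kraus_cloning_bound (K l)
  rw [← Finset.mul_sum, htr, Finset.sum_comm] at hsum
  simp only [fid_trB_sum, fid_trA_sum, Complex.re_sum, ← Finset.sum_add_distrib,
    ← Finset.sum_div]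
  linarith
end
end

section
/- Let a = −√3/6 + i/2 and let K be the 8×2 complex matrix with columns (0,a,a,0,a,0,0,0)^T and (0,0,0,a,0,a,a,0)^T. Then (i) K†K = 1_2, i.e., K is an isometry (a single-Kraus, economical channel), and (ii) for every equatorial state ψ_φ = (|0⟩ + e^{iφ}|1⟩)/√2, each of the three single-qubit reduced output states ρ_j = tr_{¬j}[K|ψ_φ⟩⟨ψ_φ|K†] (j = 1,2,3) satisfies ⟨ψ_φ| ρ_j |ψ_φ⟩ = 5/6. -/
open Matrix

noncomputable section

/-- Encode a triple `(b₁,b₂,b₃) ∈ {0,1}³` as the index `4b₁+2b₂+b₃ ∈ Fin 8`. -/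
def tri (a b c : Fin 2) : Fin 8 := ⟨4 * a.val + 2 * b.val + c.val, by omega⟩

/-- Reduced state of qubit 1 of a three-qubit state. -/
def red₁ (M : Matrix (Fin 8) (Fin 8) ℂ) : Matrix (Fin 2) (Fin 2) ℂ :=
  Matrix.of fun b b' => ∑ x : Fin 2, ∑ y : Fin 2, M (tri b x y) (tri b' x y)

/-- Reduced state of qubit 2 of a three-qubit state. -/
def red₂ (M : Matrix (Fin 8) (Fin 8) ℂ) : Matrix (Fin 2) (Fin 2) ℂ :=
  Matrix.of fun b b' => ∑ x : Fin 2, ∑ y : Fin 2, M (tri x b y) (tri x b' y)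

/-- Reduced state of qubit 3 of a three-qubit state. -/
def red₃ (M : Matrix (Fin 8) (Fin 8) ℂ) : Matrix (Fin 2) (Fin 2) ℂ :=
  Matrix.of fun b b' => ∑ x : Fin 2, ∑ y : Fin 2, M (tri x y b) (tri x y b')

/-- The constant `a = −√3/6 + i/2`. -/
def aConst : ℂ := -((Real.sqrt 3 : ℝ) : ℂ) / 6 + Complex.I / 2

/-- The single Kraus operator (isometry) of the economical phase-covariant 1→3
cloner, with columns `(0,a,a,0,a,0,0,0)ᵀ` and `(0,0,0,a,0,a,a,0)ᵀ`. -/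
def K : Matrix (Fin 8) (Fin 2) ℂ :=
  !![0, 0; aConst, 0; aConst, 0; 0, aConst; aConst, 0; 0, aConst; 0, aConst; 0, 0]

/-- The equatorial state `ψ_φ = (|0⟩ + e^{iφ}|1⟩)/√2`. -/
def eqState (φ : ℝ) : Fin 2 → ℂ :=
  ![((1 / Real.sqrt 2 : ℝ) : ℂ),
    Complex.exp (Complex.I * (φ : ℂ)) * ((1 / Real.sqrt 2 : ℝ) : ℂ)]

theorem aConst_mul_star : aConst * star aConst = 1 / 3 := by
  have h : ((Real.sqrt 3 : ℝ) : ℂ) ^ 2 = 3 := by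
    rw [← Complex.ofReal_pow, Real.sq_sqrt (by norm_num)]
    norm_num
  simp only [aConst, Complex.star_def, map_add, map_neg, map_div₀, Complex.conj_ofReal,
    Complex.conj_I, map_ofNat]
  linear_combination h / 36 - Complex.I_sq / 4

theorem eqState_zero_mul_star (φ : ℝ) : eqState φ 0 * star (eqState φ 0) = 1 / 2 := by
  have h : ((Real.sqrt 2 : ℝ) : ℂ) ^ 2 = 2 := by
    rw [← Complex.ofReal_pow, Real.sq_sqrt (by norm_num)]
    norm_num
  simp only [eqState, cons_val_zero, Complex.star_def, Complex.conj_ofReal]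
  push_cast
  rw [div_mul_div_comm, ← sq (Real.sqrt 2 : ℂ), h, one_mul]

theorem eqState_one_mul_star (φ : ℝ) : eqState φ 1 * star (eqState φ 1) = 1 / 2 := by
  have he : Complex.exp (Complex.I * φ) * star (Complex.exp (Complex.I * φ)) = 1 := by
    rw [Complex.star_def, ← Complex.exp_conj, ← Complex.exp_add]
    simp
  have h0 := eqState_zero_mul_star φ
  have h1 : eqState φ 1 = Complex.exp (Complex.I * φ) * eqState φ 0 := rfl
  rw [h1, star_mul']
  linear_combination eqState φ 0 * star (eqState φ 0) * he + h0

theorem outer_conj {m n : ℕ} (A : Matrix (Fin m) (Fin n) ℂ) (ψ : Fin n → ℂ) :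
    A * outer ψ * Aᴴ = outer (A *ᵥ ψ) := by
  have h {d : ℕ} (φ : Fin d → ℂ) : outer φ = vecMulVec φ (star φ) := rfl
  rw [h, h, mul_vecMulVec, vecMulVec_mul, star_mulVec]

theorem K_mulVec (ψ : Fin 2 → ℂ) :
    K *ᵥ ψ = ![0, aConst * ψ 0, aConst * ψ 0, aConst * ψ 1, aConst * ψ 0, aConst * ψ 1,
      aConst * ψ 1, 0] := by
  ext i
  fin_cases i <;> simp [K, mulVec, dotProduct, Fin.sum_univ_two]

theorem K_isometry : Kᴴ * K = 1 := by
  have h := aConst_mul_star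
  ext i j
  fin_cases i <;> fin_cases j <;>
    simp [K, mul_apply, Fin.sum_univ_eight] at h ⊢ <;> linear_combination 3 * h

/-- All three marginals of the clone of `ψ` coincide. -/
theorem red_K (ψ : Fin 2 → ℂ) :
    let ρ := K * outer ψ * Kᴴ
    let σ : Matrix (Fin 2) (Fin 2) ℂ :=
      (1 / 3 : ℂ) • !![2 * (ψ 0 * star (ψ 0)) + ψ 1 * star (ψ 1), 2 * (ψ 0 * star (ψ 1));
        2 * (ψ 1 * star (ψ 0)), ψ 0 * star (ψ 0) + 2 * (ψ 1 * star (ψ 1))]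
    red₁ ρ = σ ∧ red₂ ρ = σ ∧ red₃ ρ = σ := by
  intro ρ σ
  have h := aConst_mul_star
  simp only [ρ, σ, outer_conj, K_mulVec, ← h]
  refine ⟨?_, ?_, ?_⟩ <;> ext i j <;> fin_cases i <;> fin_cases j <;>
    simp [red₁, red₂, red₃, outer, tri, Fin.sum_univ_two] <;> ring

/-- The economical phase-covariant 1→3 cloner: `K` is an isometry, and for every
equatorial state each of the three single-qubit reduced output states has
fidelity `5/6` with the input. -/
theorem economical_phase_covariant_one_to_three_cloner :
    Kᴴ * K = 1 ∧
    ∀ φ : ℝ,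
      fid (eqState φ) (red₁ (K * outer (eqState φ) * Kᴴ)) = 5 / 6 ∧
      fid (eqState φ) (red₂ (K * outer (eqState φ) * Kᴴ)) = 5 / 6 ∧
      fid (eqState φ) (red₃ (K * outer (eqState φ) * Kᴴ)) = 5 / 6 := by
  refine ⟨K_isometry, fun φ => ?_⟩
  obtain ⟨h1, h2, h3⟩ := red_K (eqState φ)
  rw [h1, h2, h3, and_self, and_self]
  have hp := eqState_zero_mul_star φ
  have hq := eqState_one_mul_star φ
  simp only [fid, Fin.sum_univ_two, Matrix.smul_apply, smul_eq_mul, of_apply, cons_val_zero,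
    cons_val_one, cons_val', cons_val_fin_one]
  generalize eqState φ 0 = p at *
  generalize eqState φ 1 = q at *
  generalize star p = p' at *
  generalize star q = q' at *
  have e : p' * (1 / 3 * (2 * (p * p') + q * q')) * p + p' * (1 / 3 * (2 * (p * q'))) * q +
      (q' * (1 / 3 * (2 * (q * p'))) * p + q' * (1 / 3 * (p * p' + 2 * (q * q'))) * q) =
      1 / 3 * (2 * (p * p') ^ 2 + 6 * (p * p') * (q * q') + 2 * (q * q') ^ 2) := by ring
  rw [e, hp, hq]
  norm_num
end
end

section
/- Fix θ ∈ ℝ and let R(θ) = [[cos θ, −sin θ],[sin θ, cos θ]], and let S(θ) = {|0⟩, |1⟩, R(θ)|0⟩, R(θ)|1⟩}. For every finite family {K_k} of 4×2 complex Kraus matrices satisfying Σ_k K_k† K_k = 1_2, defining E(ρ) = Σ_k K_k ρ K_k† and single-clone fidelities F_A(ψ) = ⟨ψ| tr_B[E(|ψ⟩⟨ψ|)] |ψ⟩ and F_B(ψ) = ⟨ψ| tr_A[E(|ψ⟩⟨ψ|)] |ψ⟩, the average over the four states satisfies (1/4) Σ_{ψ ∈ S(θ)} (F_A(ψ) + F_B(ψ))/2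 ≤ (1/2)(1 + √(sin⁴θ + cos⁴θ)). -/
open Matrix

noncomputable section

/-- The rotation `R(θ) = [[cos θ, −sin θ],[sin θ, cos θ]]` as a complex matrix. -/
def R (θ : ℝ) : Matrix (Fin 2) (Fin 2) ℂ :=
  !![((Real.cos θ : ℝ) : ℂ), ((-Real.sin θ : ℝ) : ℂ);
     ((Real.sin θ : ℝ) : ℂ), ((Real.cos θ : ℝ) : ℂ)]

/-- The four states `|0⟩, |1⟩, R(θ)|0⟩, R(θ)|1⟩`. -/
def S (θ : ℝ) : Fin 4 → (Fin 2 → ℂ)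
  | 0 => ![1, 0]
  | 1 => ![0, 1]
  | 2 => (R θ).mulVec ![1, 0]
  | 3 => (R θ).mulVec ![0, 1]

/-- `⟨v, (c² U⊗U⊗1 + s² V⊗1⊗V) v⟩ ≤ √(c⁴ + s⁴) ‖v‖²` for the anticommuting reflections
`U = [[c, s], [s, -c]]` and `V = [[-s, c], [c, s]]`, where `v` has coordinates
`v (output A, output B) input` and the first tensor factor is the input. -/
lemma anticommuting_reflections_bound (c s σ : ℝ) (h : c ^ 2 + s ^ 2 = 1) (hσ : 0 < σ)
    (hσ2 : σ ^ 2 = s ^ 4 + c ^ 4) (U V : Fin 2 → Fin 2 → ℝ)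
    (hU : U = ![![c, s], ![s, -c]]) (hV : V = ![![-s, c], ![c, s]])
    (v : Fin 2 → Fin 2 → Fin 2 → ℝ) :
    ∑ a, ∑ b, ∑ i, v a b i * (c ^ 2 * ∑ a', ∑ i', U a a' * U i i' * v a' b i'
        + s ^ 2 * ∑ b', ∑ i', V b b' * V i i' * v a b' i')
      ≤ σ * ∑ a, ∑ b, ∑ i, v a b i ^ 2 := by
  set w : Fin 2 → Fin 2 → Fin 2 → ℝ := fun a b i =>
    c ^ 2 * ∑ a', ∑ i', U a a' * U i i' * v a' b i'
      + s ^ 2 * ∑ b', ∑ i', V b b' * V i i' * v a b' i' with hw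
  have hnorm : ∑ a, ∑ b, ∑ i, w a b i ^ 2 = σ ^ 2 * ∑ a, ∑ b, ∑ i, v a b i ^ 2 := by
    have hom : ∑ a, ∑ b, ∑ i, w a b i ^ 2
        = (s ^ 4 + c ^ 4) * (c ^ 2 + s ^ 2) ^ 2 * ∑ a, ∑ b, ∑ i, v a b i ^ 2 := by
      simp only [hw, hU, hV, Fin.sum_univ_two, cons_val_zero, cons_val_one]
      ring
    rw [hom, h, hσ2]; ring
  have hsq : 0 ≤ ∑ a, ∑ b, ∑ i, (σ * v a b i - w a b i) ^ 2 := by positivity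
  have hexp : ∑ a, ∑ b, ∑ i, (σ * v a b i - w a b i) ^ 2
      = σ ^ 2 * ∑ a, ∑ b, ∑ i, v a b i ^ 2 + ∑ a, ∑ b, ∑ i, w a b i ^ 2
        - 2 * σ * ∑ a, ∑ b, ∑ i, v a b i * w a b i := by
    simp only [Fin.sum_univ_two]
    ring
  rw [hexp, hnorm] at hsq
  refine le_of_mul_le_mul_left ?_ hσ
  linarith

/-- Squared amplitude, summed over both clones, of `v` mapping the real state `(x, y)` to a
state whose clone is again `(x, y)`. -/
def cloneForm (v : Fin 2 → Fin 2 → Fin 2 → ℝ) (x y : ℝ) : ℝ :=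
  ∑ b, (x * (v 0 b 0 * x + v 0 b 1 * y) + y * (v 1 b 0 * x + v 1 b 1 * y)) ^ 2
    + ∑ a, (x * (v a 0 0 * x + v a 0 1 * y) + y * (v a 1 0 * x + v a 1 1 * y)) ^ 2

lemma cloneForm_sum_le (c s σ : ℝ) (h : c ^ 2 + s ^ 2 = 1) (hσ : 0 < σ)
    (hσ2 : σ ^ 2 = s ^ 4 + c ^ 4) (v : Fin 2 → Fin 2 → Fin 2 → ℝ) :
    cloneForm v 1 0 + cloneForm v 0 1 + cloneForm v c s + cloneForm v (-s) c
      ≤ 2 * (1 + σ) * ∑ a, ∑ b, ∑ i, v a b i ^ 2 := by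
  have h1 := anticommuting_reflections_bound c s σ h hσ hσ2 _ _ rfl rfl v
  have h2 := anticommuting_reflections_bound c s σ h hσ hσ2 _ _ rfl rfl (fun a b => v b a)
  have hom : (c ^ 2 + s ^ 2) ^ 2 * (cloneForm v 1 0 + cloneForm v 0 1)
      + cloneForm v c s + cloneForm v (-s) c
      ≤ (2 * (c ^ 2 + s ^ 2) ^ 2 + 2 * σ) * ∑ a, ∑ b, ∑ i, v a b i ^ 2 := by
    simp only [Fin.sum_univ_two, cons_val_zero, cons_val_one, cloneForm] at h1 h2 ⊢
    linear_combination h1 + h2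
  rw [h] at hom
  linarith

lemma fid_clones_eq_cloneForm (x y : ℝ) (L : Matrix (Fin 2 × Fin 2) (Fin 2) ℂ) :
    (fid ![(x : ℂ), (y : ℂ)] (trB (L * outer ![(x : ℂ), (y : ℂ)] * Lᴴ))).re
      + (fid ![(x : ℂ), (y : ℂ)] (trA (L * outer ![(x : ℂ), (y : ℂ)] * Lᴴ))).re
      = cloneForm (fun a b i => (L (a, b) i).re) x y
        + cloneForm (fun a b i => (L (a, b) i).im) x y := by
  simp only [fid, trA, trB, outer, cloneForm, of_apply, mul_apply, conjTranspose_apply,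
    Fin.sum_univ_two, cons_val_zero, cons_val_one, Complex.add_re, Complex.mul_re,
    Complex.mul_im, Complex.add_im, RCLike.star_def, Complex.conj_re, Complex.conj_im,
    Complex.ofReal_re, Complex.ofReal_im]
  ring

lemma S_eq_real (θ : ℝ) :
    S θ 0 = ![((1 : ℝ) : ℂ), ((0 : ℝ) : ℂ)] ∧ S θ 1 = ![((0 : ℝ) : ℂ), ((1 : ℝ) : ℂ)]
      ∧ S θ 2 = ![((Real.cos θ : ℝ) : ℂ), ((Real.sin θ : ℝ) : ℂ)]
      ∧ S θ 3 = ![((-Real.sin θ : ℝ) : ℂ), ((Real.cos θ : ℝ) : ℂ)] := by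
  refine ⟨?_, ?_, ?_, ?_⟩ <;> ext i <;> fin_cases i <;>
    simp [S, R, mulVec, dotProduct, Fin.sum_univ_two]

lemma sum_sq_entries_eq_two {r : ℕ} (K : Fin r → Matrix (Fin 2 × Fin 2) (Fin 2) ℂ)
    (hK : ∑ k, (K k)ᴴ * K k = 1) :
    ∑ l, (∑ a, ∑ b, ∑ i, (K l (a, b) i).re ^ 2 + ∑ a, ∑ b, ∑ i, (K l (a, b) i).im ^ 2) = 2 := by
  have htr : (trace (∑ k, (K k)ᴴ * K k)).re = 2 := by simp [hK]
  rw [trace_sum, Complex.re_sum] at htr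
  rw [← htr]
  refine Finset.sum_congr rfl fun l _ => ?_
  simp only [trace, diag_apply, mul_apply, conjTranspose_apply, Fintype.sum_prod_type,
    Fin.sum_univ_two, Complex.add_re, Complex.mul_re, RCLike.star_def, Complex.conj_re,
    Complex.conj_im]
  ring

/-- Cloning two pairs of orthogonal states: for every 1→2 qubit channel given by
Kraus operators, the single-clone fidelities averaged over the four states
`|0⟩, |1⟩, R(θ)|0⟩, R(θ)|1⟩` (and over both clones) are at most
`(1/2)(1 + √(sin⁴θ + cos⁴θ))`. -/
theorem two_orthogonal_pairs_cloning_bound (θ : ℝ) {r : ℕ}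
    (K : Fin r → Matrix (Fin 2 × Fin 2) (Fin 2) ℂ)
    (hK : ∑ k, (K k)ᴴ * K k = 1) :
    (1 / 4 : ℝ) * ∑ k : Fin 4,
        ((fid (S θ k) (trB (∑ l, K l * outer (S θ k) * (K l)ᴴ))).re
          + (fid (S θ k) (trA (∑ l, K l * outer (S θ k) * (K l)ᴴ))).re) / 2
      ≤ (1 / 2) * (1 + Real.sqrt (Real.sin θ ^ 4 + Real.cos θ ^ 4)) := by
  set σ := Real.sqrt (Real.sin θ ^ 4 + Real.cos θ ^ 4) with hσ_def
  have h : Real.cos θ ^ 2 + Real.sin θ ^ 2 = 1 := Real.cos_sq_add_sin_sq θ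
  have hpos : 0 < Real.sin θ ^ 4 + Real.cos θ ^ 4 := by
    nlinarith [sq_nonneg (Real.cos θ ^ 2 - Real.sin θ ^ 2)]
  have hσ : 0 < σ := Real.sqrt_pos.mpr hpos
  have hσ2 : σ ^ 2 = Real.sin θ ^ 4 + Real.cos θ ^ 4 := Real.sq_sqrt hpos.le
  obtain ⟨h0, h1, h2, h3⟩ := S_eq_real θ
  have hbound : ∑ k : Fin 4, ∑ l,
      ((fid (S θ k) (trB (K l * outer (S θ k) * (K l)ᴴ))).re
        + (fid (S θ k) (trA (K l * outer (S θ k) * (K l)ᴴ))).re) ≤ 2 * (1 + σ) * 2 := by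
    rw [Finset.sum_comm]
    refine le_of_le_of_eq ?_ (congrArg (2 * (1 + σ) * ·) (sum_sq_entries_eq_two K hK))
    simp only [Finset.mul_sum _ _ (2 * (1 + σ))]
    refine Finset.sum_le_sum fun l _ => ?_
    rw [Fin.sum_univ_four, h0, h1, h2, h3]
    simp only [fid_clones_eq_cloneForm]
    have hre := cloneForm_sum_le _ _ σ h hσ hσ2 (fun a b i => (K l (a, b) i).re)
    have him := cloneForm_sum_le _ _ σ h hσ hσ2 (fun a b i => (K l (a, b) i).im)
    linarith
  simp only [fid_trB_sum, fid_trA_sum, Complex.re_sum, ← Finset.sum_add_distrib,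
    ← Finset.sum_div]
  linarith
end
end
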